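/- arXiv:0906.0137 — 3 statements merged into one kernel-verified Lean document; each statement's English description precedes it below -/
import Mathlib

section
/- For every integer n ≥ 3 there exists a sequence of words {a_k}_{k≥1} in the generators σ_1,…,σ_{n−1} of the braid group B_n, each representing the identity element of B_n, such that the length of a_k is 12k and d(a_k, E) = 4k², where E denotes the empty word. That is, the minimal number of applications of the braid relation σ_iσ_{i+1}σ_i = σ_{i+1}σ_iσ_{i+1} needed to transform a_k into the empty word is exactly 4k². -/
namespace Braid

/-- A letter `σ_i^{±1}`: generator index `i` and sign (`true` = `σ_i`, `false` = `σ_i⁻¹`). -/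
abbrev BraidLetter : Type := ℕ × Bool

/-- A word in the braid generators: a finite sequence of letters `σ_i^{±1}`. -/
abbrev BraidWord : Type := List BraidLetter

/-- `w` is a word in the generators `σ_1, …, σ_{n-1}` of `B_n`. -/
def IsWord (n : ℕ) (w : BraidWord) : Prop := ∀ l ∈ w, 1 ≤ l.1 ∧ l.1 < n

/-- The relators of the braid group `B_n`, inside the free group on generators
indexed by `ℕ` (only the generators `σ_1, …, σ_{n-1}` are involved in relations,
so that on words in these generators the presented group is exactly `B_n`). -/
def braidRels (n : ℕ) : Set (FreeGroup ℕ) :=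
  {r | ∃ i : ℕ, 1 ≤ i ∧ i + 2 ≤ n ∧
      r = FreeGroup.of i * FreeGroup.of (i+1) * FreeGroup.of i *
          (FreeGroup.of (i+1) * FreeGroup.of i * FreeGroup.of (i+1))⁻¹} ∪
  {r | ∃ i j : ℕ, 1 ≤ i ∧ 1 ≤ j ∧ i < n ∧ j < n ∧ i + 2 ≤ j ∧
      r = FreeGroup.of i * FreeGroup.of j * (FreeGroup.of j * FreeGroup.of i)⁻¹}

/-- The braid group `B_n`, presented by the generators `σ_i` and the braid relations. -/
abbrev BraidGroup (n : ℕ) := PresentedGroup (braidRels n)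

/-- The element of `B_n` represented by a single letter `σ_i^{±1}`. -/
def evalLetter (n : ℕ) (l : BraidLetter) : BraidGroup n :=
  if l.2 then PresentedGroup.of l.1 else (PresentedGroup.of l.1)⁻¹

/-- The element of `B_n` represented by a word. -/
def eval (n : ℕ) (w : BraidWord) : BraidGroup n := (w.map (evalLetter n)).prod

/-- Type (1) elementary modification: replacing a subword `σ_i σ_{i+1} σ_i` by
`σ_{i+1} σ_i σ_{i+1}` or vice versa, `1 ≤ i ≤ n - 2`. -/
inductive Move1 (n : ℕ) : BraidWord → BraidWord → Prop
  | fwd (u v : BraidWord) (i : ℕ) (h1 : 1 ≤ i) (h2 : i + 2 ≤ n) :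
      Move1 n (u ++ [(i, true), (i+1, true), (i, true)] ++ v)
              (u ++ [(i+1, true), (i, true), (i+1, true)] ++ v)
  | bwd (u v : BraidWord) (i : ℕ) (h1 : 1 ≤ i) (h2 : i + 2 ≤ n) :
      Move1 n (u ++ [(i+1, true), (i, true), (i+1, true)] ++ v)
              (u ++ [(i, true), (i+1, true), (i, true)] ++ v)

/-- Type (2) elementary modification: replacing a subword `σ_i σ_j` by `σ_j σ_i`
for `|i - j| ≥ 2` (in either direction, as `i` and `j` are symmetric). -/
inductive Move2 (n : ℕ) : BraidWord → BraidWord → Prop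
  | swap (u v : BraidWord) (i j : ℕ) (h1 : 1 ≤ i) (h2 : 1 ≤ j)
      (h3 : i < n) (h4 : j < n) (h5 : i + 2 ≤ j ∨ j + 2 ≤ i) :
      Move2 n (u ++ [(i, true), (j, true)] ++ v)
              (u ++ [(j, true), (i, true)] ++ v)

/-- Type (3) elementary modification: deleting or inserting a subword
`σ_i σ_i⁻¹` or `σ_i⁻¹ σ_i`. -/
inductive Move3 (n : ℕ) : BraidWord → BraidWord → Prop
  | del (u v : BraidWord) (i : ℕ) (b : Bool) (h1 : 1 ≤ i) (h2 : i < n) :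
      Move3 n (u ++ [(i, b), (i, !b)] ++ v) (u ++ v)
  | ins (u v : BraidWord) (i : ℕ) (b : Bool) (h1 : 1 ≤ i) (h2 : i < n) :
      Move3 n (u ++ v) (u ++ [(i, b), (i, !b)] ++ v)

/-- `Reach n c a b`: there is a finite sequence of elementary modifications in `B_n`
transforming `a` into `b` and containing exactly `c` modifications of type (1). -/
inductive Reach (n : ℕ) : ℕ → BraidWord → BraidWord → Prop
  | refl (a : BraidWord) : Reach n 0 a a
  | step1 {a b c : BraidWord} {k : ℕ} : Move1 n a b → Reach n k b c → Reach n (k+1) a c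
  | step2 {a b c : BraidWord} {k : ℕ} : Move2 n a b → Reach n k b c → Reach n k a c
  | step3 {a b c : BraidWord} {k : ℕ} : Move3 n a b → Reach n k b c → Reach n k a c

/-- The distance `d(a,b)`: the minimal number of type (1) modifications among all
finite sequences of elementary modifications transforming `a` into `b`. -/
noncomputable def braidDist (n : ℕ) (a b : BraidWord) : ℕ := sInf {c | Reach n c a b}

/-- A word `w` repeated `k` times. -/
def wordPow (w : BraidWord) (k : ℕ) : BraidWord := (List.replicate k w).flatten

/-- The formal inverse of a word. -/
def wordInv : BraidWord → BraidWord
  | [] => []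
  | l :: w => wordInv w ++ [(l.1, !l.2)]

lemma wordPow_zero (w : BraidWord) : wordPow w 0 = [] := rfl

lemma wordPow_succ (w : BraidWord) (k : ℕ) : wordPow w (k + 1) = w ++ wordPow w k := by
  simp [wordPow, List.replicate_succ]

lemma length_wordPow (w : BraidWord) (k : ℕ) : (wordPow w k).length = k * w.length := by
  simp [wordPow]

lemma length_wordInv (w : BraidWord) : (wordInv w).length = w.length := by
  induction w with
  | nil => rfl
  | cons l w ih => simp [wordInv, ih]

lemma IsWord.append {n : ℕ} {v w : BraidWord} (hv : IsWord n v) (hw : IsWord n w) :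
    IsWord n (v ++ w) := by
  intro l hl
  rcases List.mem_append.1 hl with h | h
  exacts [hv l h, hw l h]

lemma IsWord.wordPow {n : ℕ} {w : BraidWord} (hw : IsWord n w) (k : ℕ) :
    IsWord n (wordPow w k) := by
  intro l hl
  simp only [Braid.wordPow, List.mem_flatten, List.mem_replicate] at hl
  obtain ⟨_, ⟨_, rfl⟩, h⟩ := hl
  exact hw l h

lemma IsWord.wordInv {n : ℕ} {w : BraidWord} (hw : IsWord n w) : IsWord n (wordInv w) := by
  induction w with
  | nil => exact hw
  | cons l w ih =>
    refine IsWord.append (ih fun m hm => hw m (List.mem_cons_of_mem _ hm)) ?_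
    intro m hm
    rw [List.mem_singleton] at hm
    subst hm
    exact hw l List.mem_cons_self

/-! ### Sequences of elementary modifications -/

lemma Move1.context {n : ℕ} {a b : BraidWord} (h : Move1 n a b) (u v : BraidWord) :
    Move1 n (u ++ a ++ v) (u ++ b ++ v) := by
  cases h with
  | fwd u' v' i h1 h2 => simpa using Move1.fwd (u ++ u') (v' ++ v) i h1 h2
  | bwd u' v' i h1 h2 => simpa using Move1.bwd (u ++ u') (v' ++ v) i h1 h2

lemma Move2.context {n : ℕ} {a b : BraidWord} (h : Move2 n a b) (u v : BraidWord) :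
    Move2 n (u ++ a ++ v) (u ++ b ++ v) := by
  cases h with
  | swap u' v' i j h1 h2 h3 h4 h5 =>
    simpa using Move2.swap (u ++ u') (v' ++ v) i j h1 h2 h3 h4 h5

lemma Move3.context {n : ℕ} {a b : BraidWord} (h : Move3 n a b) (u v : BraidWord) :
    Move3 n (u ++ a ++ v) (u ++ b ++ v) := by
  cases h with
  | del u' v' i b h1 h2 => simpa using Move3.del (u ++ u') (v' ++ v) i b h1 h2
  | ins u' v' i b h1 h2 => simpa using Move3.ins (u ++ u') (v' ++ v) i b h1 h2

lemma Reach.context {n c : ℕ} {a b : BraidWord} (h : Reach n c a b) (u v : BraidWord) :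
    Reach n c (u ++ a ++ v) (u ++ b ++ v) := by
  induction h with
  | refl a => exact .refl _
  | step1 m _ ih => exact .step1 (m.context u v) ih
  | step2 m _ ih => exact .step2 (m.context u v) ih
  | step3 m _ ih => exact .step3 (m.context u v) ih

lemma Reach.trans {n c d : ℕ} {x y z : BraidWord} (h : Reach n c x y) (h' : Reach n d y z) :
    Reach n (c + d) x z := by
  induction h with
  | refl a => simpa using h'
  | step1 m _ ih => rw [Nat.add_right_comm]; exact .step1 m (ih h')
  | step2 m _ ih => exact .step2 m (ih h')
  | step3 m _ ih => exact .step3 m (ih h')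

lemma Reach.wordPow_left {n c : ℕ} {u v : BraidWord} (h : Reach n c (u ++ v) (v ++ u)) (k : ℕ) :
    Reach n (k * c) (wordPow u k ++ v) (v ++ wordPow u k) := by
  induction k with
  | zero => simpa [wordPow_zero] using Reach.refl v
  | succ k ih =>
    have h1 := (ih.context u []).trans (by simpa using h.context [] (wordPow u k))
    simpa [wordPow_succ, Nat.succ_mul] using h1

lemma Reach.wordPow_right {n c : ℕ} {u v : BraidWord} (h : Reach n c (u ++ v) (v ++ u)) (k : ℕ) :
    Reach n (k * c) (u ++ wordPow v k) (wordPow v k ++ u) := by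
  induction k with
  | zero => simpa [wordPow_zero] using Reach.refl u
  | succ k ih =>
    have h1 := (h.context [] (wordPow v k)).trans (by simpa using ih.context v [])
    simpa [wordPow_succ, Nat.succ_mul, Nat.add_comm] using h1

lemma reach_append_wordInv {n : ℕ} {w : BraidWord} (hw : IsWord n w) :
    Reach n 0 (w ++ wordInv w) [] := by
  induction w with
  | nil => exact .refl _
  | cons l w ih =>
    have hl := hw l List.mem_cons_self
    have h1 := (ih fun m hm => hw m (List.mem_cons_of_mem _ hm)).context [l] [(l.1, !l.2)]
    have h2 : Reach n 0 ([l] ++ [] ++ [(l.1, !l.2)]) [] :=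
      .step3 (.del [] [] l.1 l.2 hl.1 hl.2) (.refl _)
    simpa [wordInv] using h1.trans h2

lemma Reach.commutator {n c : ℕ} {x y : BraidWord} (hx : IsWord n x) (hy : IsWord n y)
    (h : Reach n c (x ++ y) (y ++ x)) :
    Reach n c (x ++ y ++ wordInv x ++ wordInv y) [] := by
  have h1 := h.context [] (wordInv x ++ wordInv y)
  have h2 := (reach_append_wordInv hx).context y (wordInv y)
  have h3 := h1.trans (y := y ++ x ++ (wordInv x ++ wordInv y)) (by simpa using h2)
  have h4 := h3.trans (by simpa using reach_append_wordInv hy)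
  simpa using h4

/-- Sliding `σ₁` past the full twist of the third strand around the first two takes two
braid relations. -/
lemma reach_sigma_one_comm {n : ℕ} (hn : 3 ≤ n) :
    Reach n 2 ([(1, true)] ++ [(2, true), (1, true), (1, true), (2, true)])
      ([(2, true), (1, true), (1, true), (2, true)] ++ [(1, true)]) :=
  .step1 (.fwd [] [(1, true), (2, true)] 1 le_rfl hn)
    (.step1 (.bwd [(2, true), (1, true)] [] 1 le_rfl hn) (.refl _))

/-! ### Elementary modifications preserve the braid -/

lemma eval_append (n : ℕ) (v w : BraidWord) : eval n (v ++ w) = eval n v * eval n w := by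
  simp [eval]

lemma braid_relation {n i : ℕ} (h1 : 1 ≤ i) (h2 : i + 2 ≤ n) :
    (PresentedGroup.of i * PresentedGroup.of (i + 1) * PresentedGroup.of i : BraidGroup n) =
      PresentedGroup.of (i + 1) * PresentedGroup.of i * PresentedGroup.of (i + 1) := by
  rw [← mul_inv_eq_one]
  exact PresentedGroup.one_of_mem (Or.inl ⟨i, h1, h2, rfl⟩)

lemma far_commutation {n i j : ℕ} (h1 : 1 ≤ i) (h2 : 1 ≤ j) (h3 : i < n) (h4 : j < n)
    (h5 : i + 2 ≤ j) :
    (PresentedGroup.of i * PresentedGroup.of j : BraidGroup n) =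
      PresentedGroup.of j * PresentedGroup.of i := by
  rw [← mul_inv_eq_one]
  exact PresentedGroup.one_of_mem (Or.inr ⟨i, j, h1, h2, h3, h4, h5, rfl⟩)

lemma Move1.eval_eq {n : ℕ} {a b : BraidWord} (h : Move1 n a b) : eval n a = eval n b := by
  cases h with
  | fwd u v i h1 h2 =>
    simp only [eval_append]
    congr 2
    simpa [eval, evalLetter, mul_assoc] using braid_relation h1 h2
  | bwd u v i h1 h2 =>
    simp only [eval_append]
    congr 2
    simpa [eval, evalLetter, mul_assoc] using (braid_relation h1 h2).symm

lemma Move2.eval_eq {n : ℕ} {a b : BraidWord} (h : Move2 n a b) : eval n a = eval n b := by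
  cases h with
  | swap u v i j h1 h2 h3 h4 h5 =>
    simp only [eval_append]
    congr 2
    rcases h5 with h5 | h5
    · simpa [eval, evalLetter] using far_commutation h1 h2 h3 h4 h5
    · simpa [eval, evalLetter] using (far_commutation h2 h1 h4 h3 h5).symm

lemma Move3.eval_eq {n : ℕ} {a b : BraidWord} (h : Move3 n a b) : eval n a = eval n b := by
  cases h with
  | del u v i b h1 h2 => cases b <;> simp [eval, evalLetter]
  | ins u v i b h1 h2 => cases b <;> simp [eval, evalLetter]

lemma Reach.eval_eq {n c : ℕ} {a b : BraidWord} (h : Reach n c a b) : eval n a = eval n b := by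
  induction h with
  | refl a => rfl
  | step1 m _ ih => exact m.eval_eq.trans ih
  | step2 m _ ih => exact m.eval_eq.trans ih
  | step3 m _ ih => exact m.eval_eq.trans ih

/-! ### Counting ordered pairs of crossings -/

/-- The sign `±1` of a letter. -/
def letterSign (b : Bool) : ℤ := if b then 1 else -1

/-- The indicator of `{p, q} = {r, s}`, for `r ≠ s`. -/
def pairIndicator (r s p q : ℕ) : ℤ := if p = r ∧ q = s ∨ p = s ∧ q = r then 1 else 0

/-- Read one letter, keeping track of which strand is at which position, of the signed number
of crossings of the strands `1` and `2`, and of the signed number of pairs formed by a crossing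
of the strands `1` and `2` and a later crossing of the strands `1` and `3`. -/
def crossStep (s : Equiv.Perm ℕ × ℤ × ℤ) (l : BraidLetter) : Equiv.Perm ℕ × ℤ × ℤ :=
  (s.1 * Equiv.swap l.1 (l.1 + 1),
    s.2.1 + letterSign l.2 * pairIndicator 1 2 (s.1 l.1) (s.1 (l.1 + 1)),
    s.2.2 + s.2.1 * (letterSign l.2 * pairIndicator 1 3 (s.1 l.1) (s.1 (l.1 + 1))))

/-- The signed number of pairs formed by a crossing of the strands `1` and `2` and a later
crossing of the strands `1` and `3`. -/
def pairCount (w : BraidWord) : ℤ := (w.foldl crossStep (1, 0, 0)).2.2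

lemma pairIndicator_swap (r s p q : ℕ) : pairIndicator r s q p = pairIndicator r s p q := by
  unfold pairIndicator
  congr 1
  grind

lemma pairIndicator_mul (p q : ℕ) : pairIndicator 1 2 p q * pairIndicator 1 3 p q = 0 := by
  unfold pairIndicator
  split_ifs <;> omega

lemma pairIndicator_mul_of_disjoint {p q r s : ℕ} (h1 : p ≠ r) (h2 : p ≠ s) (h3 : q ≠ r)
    (h4 : q ≠ s) : pairIndicator 1 2 p q * pairIndicator 1 3 r s = 0 := by
  unfold pairIndicator
  split_ifs <;> omega

/-- Reversing the order of the three crossings of three strands changes the number of ordered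
pairs by at most one. -/
lemma abs_pairIndicator_reverse_le (p q r : ℕ) :
    |pairIndicator 1 2 p q * (pairIndicator 1 3 p r + pairIndicator 1 3 q r) +
        pairIndicator 1 2 p r * pairIndicator 1 3 q r -
      (pairIndicator 1 2 q r * (pairIndicator 1 3 p r + pairIndicator 1 3 p q) +
        pairIndicator 1 2 p r * pairIndicator 1 3 p q)| ≤ 1 := by
  unfold pairIndicator
  split_ifs <;> first | omega | simp

lemma crossStep_not_crossStep (s : Equiv.Perm ℕ × ℤ × ℤ) (i : ℕ) (b : Bool) :
    crossStep (crossStep s (i, b)) (i, !b) = s := by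
  obtain ⟨f, x, y⟩ := s
  have h := pairIndicator_mul (f i) (f (i + 1))
  have hb : letterSign (!b) = -letterSign b := by cases b <;> simp [letterSign]
  refine Prod.ext ?_ (Prod.ext ?_ ?_)
  · simp [crossStep, mul_assoc]
  · simp [crossStep, hb, pairIndicator_swap]
  · simp only [crossStep, hb, Equiv.Perm.mul_apply, Equiv.swap_apply_left,
      Equiv.swap_apply_right, pairIndicator_swap 1 3 (f i)]
    linear_combination (-letterSign b ^ 2) * h

lemma foldl_crossStep_wordInv (w : BraidWord) (s : Equiv.Perm ℕ × ℤ × ℤ) :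
    (wordInv w).foldl crossStep (w.foldl crossStep s) = s := by
  induction w generalizing s with
  | nil => rfl
  | cons l w ih =>
    simp only [wordInv, List.foldl_cons, List.foldl_append, ih, List.foldl_nil]
    exact crossStep_not_crossStep s l.1 l.2

lemma crossStep_comm (s : Equiv.Perm ℕ × ℤ × ℤ) {i j : ℕ} (b c : Bool)
    (h : i + 2 ≤ j ∨ j + 2 ≤ i) :
    crossStep (crossStep s (i, b)) (j, c) = crossStep (crossStep s (j, c)) (i, b) := by
  obtain ⟨f, x, y⟩ := s
  have e1 : Equiv.swap i (i + 1) j = j := Equiv.swap_apply_of_ne_of_ne (by omega) (by omega)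
  have e2 : Equiv.swap i (i + 1) (j + 1) = j + 1 :=
    Equiv.swap_apply_of_ne_of_ne (by omega) (by omega)
  have e3 : Equiv.swap j (j + 1) i = i := Equiv.swap_apply_of_ne_of_ne (by omega) (by omega)
  have e4 : Equiv.swap j (j + 1) (i + 1) = i + 1 :=
    Equiv.swap_apply_of_ne_of_ne (by omega) (by omega)
  have hij : pairIndicator 1 2 (f i) (f (i + 1)) * pairIndicator 1 3 (f j) (f (j + 1)) = 0 := by
    apply pairIndicator_mul_of_disjoint <;> exact f.injective.ne (by omega)
  have hji : pairIndicator 1 2 (f j) (f (j + 1)) * pairIndicator 1 3 (f i) (f (i + 1)) = 0 := by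
    apply pairIndicator_mul_of_disjoint <;> exact f.injective.ne (by omega)
  refine Prod.ext ?_ (Prod.ext ?_ ?_)
  · ext m
    simp only [crossStep, Equiv.Perm.mul_apply]
    congr 1
    simp only [Equiv.swap_apply_def]
    grind
  · simp only [crossStep, Equiv.Perm.mul_apply, e1, e2, e3, e4]
    ring
  · simp only [crossStep, Equiv.Perm.mul_apply, e1, e2, e3, e4]
    linear_combination (letterSign b * letterSign c) * (hij - hji)

/-- Shifting the initial count by `e` shifts the final count by `e`. -/
lemma foldl_crossStep_shift (w : BraidWord) (f : Equiv.Perm ℕ) (x y e : ℤ) :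
    (w.foldl crossStep (f, x, y + e)).2.2 = (w.foldl crossStep (f, x, y)).2.2 + e := by
  induction w generalizing f x y with
  | nil => rfl
  | cons l w ih =>
    simp only [List.foldl_cons, crossStep]
    rw [← ih, add_right_comm]

lemma foldl_crossStep_braid (v : BraidWord) (s : Equiv.Perm ℕ × ℤ × ℤ) (i : ℕ) :
    |(([(i, true), (i + 1, true), (i, true)] ++ v).foldl crossStep s).2.2 -
      (([(i + 1, true), (i, true), (i + 1, true)] ++ v).foldl crossStep s).2.2| ≤ 1 := by
  obtain ⟨f, x, y⟩ := s
  have e1 : Equiv.swap i (i + 1) (i + 1 + 1) = i + 2 :=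
    Equiv.swap_apply_of_ne_of_ne (by omega) (by omega)
  have e2 : Equiv.swap (i + 1) (i + 1 + 1) i = i :=
    Equiv.swap_apply_of_ne_of_ne (by omega) (by omega)
  set A := pairIndicator 1 2
  set B := pairIndicator 1 3
  set p := f i
  set q := f (i + 1)
  set r := f (i + 2)
  have hl : [(i, true), (i + 1, true), (i, true)].foldl crossStep (f, x, y) =
      (f * (Equiv.swap i (i + 1) * Equiv.swap (i + 1) (i + 2) * Equiv.swap i (i + 1)),
        x + (A p q + A p r + A q r),
        y + x * (B p q + B p r + B q r) + (A p q * (B p r + B q r) + A p r * B q r)) := by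
    refine Prod.ext ?_ (Prod.ext ?_ ?_)
    · simp [crossStep, mul_assoc]
    · simp [crossStep, letterSign, e1, e2, A, p, q, r]
      ring
    · simp [crossStep, letterSign, e1, e2, A, B, p, q, r]
      ring
  have hr : [(i + 1, true), (i, true), (i + 1, true)].foldl crossStep (f, x, y) =
      (f * (Equiv.swap i (i + 1) * Equiv.swap (i + 1) (i + 2) * Equiv.swap i (i + 1)),
        x + (A p q + A p r + A q r),
        y + x * (B p q + B p r + B q r) + (A q r * (B p r + B p q) + A p r * B p q)) := by
    refine Prod.ext ?_ (Prod.ext ?_ ?_)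
    · simp only [List.foldl_cons, List.foldl_nil, crossStep, mul_assoc]
      congr 1
      ext m
      simp only [Equiv.Perm.mul_apply, Equiv.swap_apply_def]
      grind
    · simp [crossStep, letterSign, e1, e2, A, p, q, r]
      ring
    · simp [crossStep, letterSign, e1, e2, A, B, p, q, r]
      ring
  rw [List.foldl_append, List.foldl_append, hl, hr, foldl_crossStep_shift _ _ _ (y + _),
    foldl_crossStep_shift _ _ _ (y + _), add_sub_add_left_eq_sub]
  exact abs_pairIndicator_reverse_le p q r

lemma Move1.abs_pairCount_sub_le {n : ℕ} {a b : BraidWord} (h : Move1 n a b) :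
    |pairCount a - pairCount b| ≤ 1 := by
  cases h with
  | fwd u v i h1 h2 =>
    simp only [pairCount, List.append_assoc, List.foldl_append (l := u)]
    exact foldl_crossStep_braid v _ i
  | bwd u v i h1 h2 =>
    simp only [pairCount, List.append_assoc, List.foldl_append (l := u)]
    rw [abs_sub_comm]
    exact foldl_crossStep_braid v _ i

lemma Move2.pairCount_eq {n : ℕ} {a b : BraidWord} (h : Move2 n a b) :
    pairCount a = pairCount b := by
  cases h with
  | swap u v i j h1 h2 h3 h4 h5 =>
    simp only [pairCount, List.foldl_append, List.foldl_cons, List.foldl_nil,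
      crossStep_comm _ _ _ h5]

lemma Move3.pairCount_eq {n : ℕ} {a b : BraidWord} (h : Move3 n a b) :
    pairCount a = pairCount b := by
  cases h with
  | del u v i b h1 h2 => simp [pairCount, crossStep_not_crossStep]
  | ins u v i b h1 h2 => simp [pairCount, crossStep_not_crossStep]

lemma Reach.abs_pairCount_sub_le {n c : ℕ} {a b : BraidWord} (h : Reach n c a b) :
    |pairCount a - pairCount b| ≤ c := by
  induction h with
  | refl a => simp
  | @step1 a b c k m _ ih =>
    have h1 := abs_sub_le (pairCount a) (pairCount b) (pairCount c)
    have h2 := m.abs_pairCount_sub_le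
    push_cast
    linarith
  | step2 m _ ih => rwa [m.pairCount_eq]
  | step3 m _ ih => rwa [m.pairCount_eq]

/-! ### The commutator words -/

lemma foldl_crossStep_wordPow_one (k : ℕ) (x y : ℤ) :
    (wordPow [(1, true), (1, true)] k).foldl crossStep (1, x, y) = (1, x + 2 * k, y) := by
  induction k generalizing x with
  | zero => simp [wordPow_zero]
  | succ k ih =>
    have h : [(1, true), (1, true)].foldl crossStep (1, x, y) = (1, x + 2, y) := by
      simp [crossStep, letterSign, pairIndicator, add_assoc]
    rw [wordPow_succ, List.foldl_append, h, ih]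
    push_cast
    ring_nf

lemma foldl_crossStep_wordPow_two (k : ℕ) (x y : ℤ) :
    (wordPow [(2, true), (1, true), (1, true), (2, true)] k).foldl crossStep (1, x, y) =
      (1, x, y + 2 * k * x) := by
  induction k generalizing y with
  | zero => simp [wordPow_zero]
  | succ k ih =>
    have e : Equiv.swap 2 3 1 = 1 := by decide
    have h : [(2, true), (1, true), (1, true), (2, true)].foldl crossStep (1, x, y) =
        (1, x, y + 2 * x) := by
      refine Prod.ext ?_ (Prod.ext ?_ ?_)
      · simp [crossStep, mul_assoc]
      · simp [crossStep, letterSign, pairIndicator, e]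
      · simp [crossStep, letterSign, pairIndicator, e]
        ring
    rw [wordPow_succ, List.foldl_append, h, ih]
    push_cast
    ring_nf

/-- For every `n ≥ 3` there is a sequence of words `a_k` in the generators
`σ_1, …, σ_{n-1}` of `B_n`, each representing the identity element of `B_n`,
of length `12k`, with `d(a_k, E) = 4k²` where `E` is the empty word. -/
theorem statement_0 (n : ℕ) (hn : 3 ≤ n) :
    ∃ a : ℕ → BraidWord,
      ∀ k : ℕ, 1 ≤ k →
        IsWord n (a k) ∧
        eval n (a k) = 1 ∧
        (a k).length = 12 * k ∧
        braidDist n (a k) [] = 4 * k ^ 2 := by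
  have hx : IsWord n [(1, true), (1, true)] := by
    intro l hl
    simp only [List.mem_cons, List.not_mem_nil, or_false, or_self] at hl
    subst hl
    exact ⟨le_rfl, by omega⟩
  have hy : IsWord n [(2, true), (1, true), (1, true), (2, true)] := by
    intro l hl
    simp only [List.mem_cons, List.not_mem_nil, or_false] at hl
    rcases hl with rfl | rfl | rfl | rfl <;> exact ⟨by decide, by simp only; omega⟩
  refine ⟨fun k => wordPow [(1, true), (1, true)] k ++
    wordPow [(2, true), (1, true), (1, true), (2, true)] k ++
    wordInv (wordPow [(1, true), (1, true)] k) ++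
    wordInv (wordPow [(2, true), (1, true), (1, true), (2, true)] k), fun k _ => ?_⟩
  have hxk := hx.wordPow k
  have hyk := hy.wordPow k
  have hcomm := (((reach_sigma_one_comm hn).wordPow_left 2).wordPow_left k).wordPow_right k
  have hreach := Reach.commutator hxk hyk hcomm
  refine ⟨((hxk.append hyk).append hxk.wordInv).append hyk.wordInv, hreach.eval_eq, ?_, ?_⟩
  · simp only [List.length_append, length_wordInv, length_wordPow, List.length_cons,
      List.length_nil]
    ring
  · have hc : k * (k * (2 * 2)) = 4 * k ^ 2 := by ring
    rw [hc] at hreach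
    refine le_antisymm (Nat.sInf_le hreach) (le_csInf ⟨_, hreach⟩ fun c h => ?_)
    have hle := Reach.abs_pairCount_sub_le h
    have hinvx := foldl_crossStep_wordInv (wordPow [(1, true), (1, true)] k)
      (1, 0, 4 * (k : ℤ) ^ 2)
    have hinvy := foldl_crossStep_wordInv
      (wordPow [(2, true), (1, true), (1, true), (2, true)] k) (1, 0, 4 * (k : ℤ) ^ 2)
    rw [foldl_crossStep_wordPow_one] at hinvx
    rw [foldl_crossStep_wordPow_two, mul_zero, add_zero] at hinvy
    have hxy : (0 : ℤ) + 2 * k * (0 + 2 * k) = 4 * (k : ℤ) ^ 2 := by ring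
    simp only [pairCount, List.foldl_append, foldl_crossStep_wordPow_one,
      foldl_crossStep_wordPow_two, hxy, hinvx, hinvy, List.foldl_nil, sub_zero] at hle
    exact_mod_cast (le_abs_self _).trans hle

end Braid
end

section
/- Let m > n and let a, b be words in the generators σ_1,…,σ_{n−1} representing the same element of B_n (and hence, under the natural embedding B_n ↪ B_m given on generators by σ_i ↦ σ_i, representing the same element of B_m). Then the distance d(a,b) computed in B_n equals the distance d(a,b) computed in B_m. -/
namespace Braid

/-- The position, at the end of the braid diagram `w`, of the strand that starts at position `p`. -/
def track : ℕ → BraidWord → ℕ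
  | p, [] => p
  | p, (i, _) :: w => track (if p = i then i + 1 else if p = i + 1 then i else p) w

/-- The word obtained from the braid diagram `w` by erasing the strand that starts
at position `p`. -/
def forget : ℕ → BraidWord → BraidWord
  | _, [] => []
  | p, (i, b) :: w =>
    if p = i then forget (i + 1) w
    else if p = i + 1 then forget i w
    else if p < i then (i - 1, b) :: forget p w
    else (i, b) :: forget p w

theorem track_append (p : ℕ) (u v : BraidWord) :
    track p (u ++ v) = track (track p u) v := by
  induction u generalizing p with
  | nil => rfl
  | cons l u ih => exact ih _

theorem forget_append (p : ℕ) (u v : BraidWord) :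
    forget p (u ++ v) = forget p u ++ forget (track p u) v := by
  induction u generalizing p with
  | nil => rfl
  | cons l u ih =>
    obtain ⟨i, b⟩ := l
    simp only [List.cons_append, forget, track]
    split_ifs <;> simp [ih]

theorem track_mem {n p : ℕ} {w : BraidWord} (hw : IsWord n w) (h1 : 1 ≤ p) (h2 : p ≤ n) :
    1 ≤ track p w ∧ track p w ≤ n := by
  induction w generalizing p with
  | nil => exact ⟨h1, h2⟩
  | cons l w ih =>
    have hl := hw l (by simp)
    refine ih (fun k hk => hw k (by simp [hk])) ?_ ?_ <;> split_ifs <;> omega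

theorem isWord_append {n : ℕ} {u v : BraidWord} :
    IsWord n (u ++ v) ↔ IsWord n u ∧ IsWord n v := by
  simp only [IsWord, List.mem_append]
  grind

theorem IsWord.mono {n m : ℕ} (h : n ≤ m) {w : BraidWord} (hw : IsWord n w) : IsWord m w :=
  fun l hl => ⟨(hw l hl).1, (hw l hl).2.trans_le h⟩

theorem forget_eq_self {n p : ℕ} {w : BraidWord} (hw : IsWord n w) (h : n < p) :
    forget p w = w := by
  induction w with
  | nil => rfl
  | cons l w ih =>
    have hl := hw l (by simp)
    have hw' := ih (fun k hk => hw k (by simp [hk]))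
    rw [forget, if_neg (by omega), if_neg (by omega), if_neg (by omega), hw']

theorem Move1.isWord {n : ℕ} {x y : BraidWord} (h : Move1 n x y) (hx : IsWord n x) :
    IsWord n y := by
  cases h <;> simp [IsWord] at hx ⊢ <;> grind

theorem Move2.isWord {n : ℕ} {x y : BraidWord} (h : Move2 n x y) (hx : IsWord n x) :
    IsWord n y := by
  cases h; simp [IsWord] at hx ⊢; grind

theorem Move3.isWord {n : ℕ} {x y : BraidWord} (h : Move3 n x y) (hx : IsWord n x) :
    IsWord n y := by
  cases h <;> simp [IsWord] at hx ⊢ <;> grind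

theorem track_braid (p i : ℕ) :
    track p [(i, true), (i+1, true), (i, true)] =
      track p [(i+1, true), (i, true), (i+1, true)] := by
  simp only [track]; grind

theorem forget_braid {n p i : ℕ} (hp : 1 ≤ p) (hp' : p ≤ n + 1) (hi : 1 ≤ i)
    (hi' : i + 2 ≤ n + 1) :
    forget p [(i, true), (i+1, true), (i, true)] =
        forget p [(i+1, true), (i, true), (i+1, true)] ∨
      ∃ j, 1 ≤ j ∧ j + 2 ≤ n ∧
        forget p [(i, true), (i+1, true), (i, true)] = [(j, true), (j+1, true), (j, true)] ∧
        forget p [(i+1, true), (i, true), (i+1, true)] =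
          [(j+1, true), (j, true), (j+1, true)] := by
  by_cases h : p < i
  · exact .inr ⟨i - 1, by grind [forget]⟩
  by_cases h' : i + 2 < p
  · exact .inr ⟨i, by grind [forget]⟩
  · exact .inl (by grind [forget])

theorem track_swap {p i j : ℕ} (h : i + 2 ≤ j ∨ j + 2 ≤ i) :
    track p [(i, true), (j, true)] = track p [(j, true), (i, true)] := by
  simp only [track]; grind

theorem forget_swap {n p i j : ℕ} (hp : 1 ≤ p) (hp' : p ≤ n + 1) (hi : 1 ≤ i) (hj : 1 ≤ j)
    (hi' : i < n + 1) (hj' : j < n + 1) (h : i + 2 ≤ j ∨ j + 2 ≤ i) :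
    forget p [(i, true), (j, true)] = forget p [(j, true), (i, true)] ∨
      ∃ k l, 1 ≤ k ∧ 1 ≤ l ∧ k < n ∧ l < n ∧ (k + 2 ≤ l ∨ l + 2 ≤ k) ∧
        forget p [(i, true), (j, true)] = [(k, true), (l, true)] ∧
        forget p [(j, true), (i, true)] = [(l, true), (k, true)] := by
  by_cases h1 : p = i ∨ p = i + 1 ∨ p = j ∨ p = j + 1
  · left; simp only [forget]; grind
  · exact .inr ⟨if p < i then i - 1 else i, if p < j then j - 1 else j, by grind [forget]⟩

theorem track_cancel (p i : ℕ) (b : Bool) : track p [(i, b), (i, !b)] = p := by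
  simp only [track]; grind

theorem forget_cancel {n p i : ℕ} (b : Bool) (hp : 1 ≤ p) (hp' : p ≤ n + 1) (hi : 1 ≤ i)
    (hi' : i < n + 1) :
    forget p [(i, b), (i, !b)] = [] ∨
      ∃ j, 1 ≤ j ∧ j < n ∧ forget p [(i, b), (i, !b)] = [(j, b), (j, !b)] := by
  by_cases h1 : p = i ∨ p = i + 1
  · left; grind [forget]
  · exact .inr ⟨if p < i then i - 1 else i, by grind [forget]⟩

theorem Move1.forget {n p : ℕ} {x y : BraidWord} (h : Move1 (n + 1) x y)
    (hx : IsWord (n + 1) x) (hp : 1 ≤ p) (hp' : p ≤ n + 1) :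
    forget p x = forget p y ∨ Move1 n (forget p x) (forget p y) := by
  cases h with
  | fwd u v i h1 h2 =>
    obtain ⟨hq, hq'⟩ := track_mem (isWord_append.1 (isWord_append.1 hx).1).1 hp hp'
    simp only [forget_append, track_append, track_braid]
    obtain e | ⟨j, hj, hj', e, e'⟩ := forget_braid hq hq' h1 h2
    · exact .inl (by rw [e])
    · rw [e, e']; exact .inr (.fwd _ _ _ hj hj')
  | bwd u v i h1 h2 =>
    obtain ⟨hq, hq'⟩ := track_mem (isWord_append.1 (isWord_append.1 hx).1).1 hp hp'
    simp only [forget_append, track_append, track_braid]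
    obtain e | ⟨j, hj, hj', e, e'⟩ := forget_braid hq hq' h1 h2
    · exact .inl (by rw [e])
    · rw [e, e']; exact .inr (.bwd _ _ _ hj hj')

theorem Move2.forget {n p : ℕ} {x y : BraidWord} (h : Move2 (n + 1) x y)
    (hx : IsWord (n + 1) x) (hp : 1 ≤ p) (hp' : p ≤ n + 1) :
    forget p x = forget p y ∨ Move2 n (forget p x) (forget p y) := by
  obtain ⟨u, v, i, j, h1, h2, h3, h4, h5⟩ := h
  obtain ⟨hq, hq'⟩ := track_mem (isWord_append.1 (isWord_append.1 hx).1).1 hp hp'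
  simp only [forget_append, track_append, track_swap h5]
  obtain e | ⟨k, l, hk, hl, hk', hl', hkl, e, e'⟩ := forget_swap hq hq' h1 h2 h3 h4 h5
  · exact .inl (by rw [e])
  · rw [e, e']; exact .inr (.swap _ _ _ _ hk hl hk' hl' hkl)

theorem Move3.forget {n p : ℕ} {x y : BraidWord} (h : Move3 (n + 1) x y)
    (hx : IsWord (n + 1) x) (hp : 1 ≤ p) (hp' : p ≤ n + 1) :
    forget p x = forget p y ∨ Move3 n (forget p x) (forget p y) := by
  cases h with
  | del u v i b h1 h2 =>
    obtain ⟨hq, hq'⟩ := track_mem (isWord_append.1 (isWord_append.1 hx).1).1 hp hp'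
    simp only [forget_append, track_append, track_cancel]
    obtain e | ⟨j, hj, hj', e⟩ := forget_cancel b hq hq' h1 h2
    · exact .inl (by rw [e, List.append_nil])
    · rw [e]; exact .inr (.del _ _ _ _ hj hj')
  | ins u v i b h1 h2 =>
    obtain ⟨hq, hq'⟩ := track_mem (isWord_append.1 hx).1 hp hp'
    simp only [forget_append, track_append, track_cancel]
    obtain e | ⟨j, hj, hj', e⟩ := forget_cancel b hq hq' h1 h2
    · exact .inl (by rw [e, List.append_nil])
    · rw [e]; exact .inr (.ins _ _ _ _ hj hj')

/-- Erasing a strand does not increase the number of type (1) modifications. -/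
theorem Reach.forget {n p c : ℕ} {x y : BraidWord} (h : Reach (n + 1) c x y)
    (hx : IsWord (n + 1) x) (hp : 1 ≤ p) (hp' : p ≤ n + 1) :
    ∃ c' ≤ c, Reach n c' (forget p x) (forget p y) := by
  induction h with
  | refl => exact ⟨0, le_rfl, .refl _⟩
  | step1 hm _ ih =>
    obtain ⟨c', hc, hr⟩ := ih (hm.isWord hx)
    obtain e | hm' := hm.forget hx hp hp'
    · exact ⟨c', by omega, e ▸ hr⟩
    · exact ⟨c' + 1, by omega, .step1 hm' hr⟩
  | step2 hm _ ih =>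
    obtain ⟨c', hc, hr⟩ := ih (hm.isWord hx)
    obtain e | hm' := hm.forget hx hp hp'
    · exact ⟨c', hc, e ▸ hr⟩
    · exact ⟨c', hc, .step2 hm' hr⟩
  | step3 hm _ ih =>
    obtain ⟨c', hc, hr⟩ := ih (hm.isWord hx)
    obtain e | hm' := hm.forget hx hp hp'
    · exact ⟨c', hc, e ▸ hr⟩
    · exact ⟨c', hc, .step3 hm' hr⟩

theorem Reach.mono {n m c : ℕ} (hnm : n ≤ m) {x y : BraidWord} (h : Reach n c x y) :
    Reach m c x y := by
  induction h with
  | refl => exact .refl _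
  | step1 hm _ ih =>
    refine .step1 ?_ ih
    cases hm with
    | fwd u v i h1 h2 => exact .fwd u v i h1 (by omega)
    | bwd u v i h1 h2 => exact .bwd u v i h1 (by omega)
  | step2 hm _ ih =>
    obtain ⟨u, v, i, j, h1, h2, h3, h4, h5⟩ := hm
    exact .step2 (.swap u v i j h1 h2 (by omega) (by omega) h5) ih
  | step3 hm _ ih =>
    refine .step3 ?_ ih
    cases hm with
    | del u v i b h1 h2 => exact .del u v i b h1 (by omega)
    | ins u v i b h1 h2 => exact .ins u v i b h1 (by omega)

theorem Reach.exists_le_of_isWord {n m c : ℕ} (hnm : n ≤ m) {a b : BraidWord}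
    (ha : IsWord n a) (hb : IsWord n b) (h : Reach m c a b) : ∃ c' ≤ c, Reach n c' a b := by
  induction m, hnm using Nat.le_induction generalizing c with
  | base => exact ⟨c, le_rfl, h⟩
  | succ m hnm ih =>
    obtain ⟨c', hc, hr⟩ := h.forget (ha.mono (by omega)) (Nat.succ_pos m) le_rfl
    rw [forget_eq_self ha (by omega), forget_eq_self hb (by omega)] at hr
    obtain ⟨d, hd, hr'⟩ := ih hr
    exact ⟨d, hd.trans hc, hr'⟩

/-- For `m > n` and words `a, b` in the generators `σ_1, …, σ_{n-1}` representing
the same element of `B_n`, the distance `d(a,b)` computed in `B_n` equals the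
distance computed in `B_m`. -/
theorem statement_1 (n m : ℕ) (hnm : n < m) (a b : BraidWord)
    (ha : IsWord n a) (hb : IsWord n b) (hab : eval n a = eval n b) :
    braidDist n a b = braidDist m a b := by
  obtain h | h := {c | Reach m c a b}.eq_empty_or_nonempty
  · have hn : {c | Reach n c a b} = ∅ :=
      Set.eq_empty_of_forall_notMem fun c hc => h.subset (Reach.mono hnm.le hc)
    rw [braidDist, braidDist, h, hn]
  · obtain ⟨c, hc, hr⟩ := Reach.exists_le_of_isWord hnm.le ha hb (Nat.sInf_mem h)
    exact le_antisymm ((Nat.sInf_le hr).trans hc)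
      (Nat.sInf_le (Reach.mono hnm.le (Nat.sInf_mem (s := {c | Reach n c a b}) ⟨c, hr⟩)))

end Braid
end

section
/- For every k ≥ 1, d(a_k, b_k) ≥ 4k²: every sequence of elementary modifications transforming a_k = W^{−k} V^k W^k V^{−k} into b_k = W^{−k} W^k V^k V^{−k} contains at least 4k² modifications of type (1), i.e., at least 4k² applications of the relation σ_1σ_2σ_1 = σ_2σ_1σ_2. -/
namespace Braid

/-- The `k`-fold concatenation `w^k` of a word. -/
def wpow (w : BraidWord) (k : ℕ) : BraidWord := (List.replicate k w).flatten

/-- The formal inverse `w⁻¹` of a word: letters inverted and order reversed. -/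
def winv (w : BraidWord) : BraidWord := w.reverse.map (fun l => (l.1, !l.2))

/-- The word `V = σ_1²`. -/
def V : BraidWord := [(1, true), (1, true)]

/-- The word `W = σ_2 σ_1² σ_2`. -/
def W : BraidWord := [(2, true), (1, true), (1, true), (2, true)]

/-- The word `a_k = W^{-k} V^k W^k V^{-k}`. -/
def ak (k : ℕ) : BraidWord := winv (wpow W k) ++ wpow V k ++ wpow W k ++ winv (wpow V k)

/-- The word `b_k = W^{-k} W^k V^k V^{-k}`. -/
def bk (k : ℕ) : BraidWord := winv (wpow W k) ++ wpow W k ++ wpow V k ++ winv (wpow V k)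


/-- Follow a marked strand, starting at position `p`, through a braid word. The integer `N` is the
signed number of crossings that involve the marked strand so far; each crossing `σ_i^{±1}` between
two other strands contributes `±N`. The value is the sum of these contributions. -/
def strandWeight : ℕ → ℤ → BraidWord → ℤ
  | _, _, [] => 0
  | p, N, (i, b) :: w =>
    if p = i then strandWeight (i + 1) (N + letterSign b) w
    else if p = i + 1 then strandWeight i (N + letterSign b) w
    else letterSign b * N + strandWeight p N w

theorem abs_strandWeight_append_sub_le {s t : BraidWord} {c : ℤ}
    (h : ∀ p N, |strandWeight p N s - strandWeight p N t| ≤ c) (u : BraidWord) (p : ℕ) (N : ℤ) :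
    |strandWeight p N (u ++ s) - strandWeight p N (u ++ t)| ≤ c := by
  induction u generalizing p N with
  | nil => exact h p N
  | cons l u ih =>
    obtain ⟨i, b⟩ := l
    simp only [List.cons_append, strandWeight]
    split_ifs
    · exact ih _ _
    · exact ih _ _
    · rw [add_sub_add_left_eq_sub]
      exact ih _ _

theorem abs_strandWeight_braid_sub_le (v : BraidWord) (i p : ℕ) (N : ℤ) :
    |strandWeight p N ([(i, true), (i + 1, true), (i, true)] ++ v) -
      strandWeight p N ([(i + 1, true), (i, true), (i + 1, true)] ++ v)| ≤ 2 := by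
  by_cases h0 : p = i
  · subst h0
    simp [strandWeight, letterSign]
    grind
  by_cases h1 : p = i + 1
  · subst h1
    simp [strandWeight, letterSign]
    grind
  by_cases h2 : p = i + 2
  · subst h2
    simp [strandWeight, letterSign]
    grind
  simp [strandWeight, h0, h1, h2]

theorem strandWeight_cancel (v : BraidWord) (i : ℕ) (b : Bool) (p : ℕ) (N : ℤ) :
    strandWeight p N ([(i, b), (i, !b)] ++ v) = strandWeight p N v := by
  by_cases h0 : p = i
  · cases b <;> simp [strandWeight, letterSign, h0]
  by_cases h1 : p = i + 1
  · cases b <;> simp [strandWeight, letterSign, h1]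
  cases b <;> simp [strandWeight, letterSign, h0, h1]

theorem Move1.abs_strandWeight_sub_le {n : ℕ} {a b : BraidWord} (h : Move1 n a b) (p : ℕ) (N : ℤ) :
    |strandWeight p N a - strandWeight p N b| ≤ 2 := by
  cases h with
  | fwd u v i =>
    simp only [List.append_assoc u]
    exact abs_strandWeight_append_sub_le (abs_strandWeight_braid_sub_le v i) u p N
  | bwd u v i =>
    rw [abs_sub_comm]
    simp only [List.append_assoc u]
    exact abs_strandWeight_append_sub_le (abs_strandWeight_braid_sub_le v i) u p N

theorem Move3.strandWeight_eq {n : ℕ} {a b : BraidWord} (h : Move3 n a b) (p : ℕ) (N : ℤ) :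
    strandWeight p N a = strandWeight p N b := by
  have key (u v : BraidWord) (i : ℕ) (b : Bool) :
      strandWeight p N (u ++ [(i, b), (i, !b)] ++ v) = strandWeight p N (u ++ v) := by
    rw [List.append_assoc, ← sub_eq_zero, ← abs_nonpos_iff]
    exact abs_strandWeight_append_sub_le
      (fun p N => by rw [strandWeight_cancel, sub_self, abs_zero]) u p N
  cases h with
  | del u v i b => exact key u v i b
  | ins u v i b => exact (key u v i b).symm

theorem not_move2_three (a b : BraidWord) : ¬ Move2 3 a b := by
  rintro ⟨u, v, i, j, h1, h2, h3, h4, h5⟩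
  omega

theorem Reach.abs_strandWeight_sub_le {c : ℕ} {a b : BraidWord} (h : Reach 3 c a b)
    (p : ℕ) (N : ℤ) : |strandWeight p N a - strandWeight p N b| ≤ 2 * c := by
  induction h with
  | refl => simp
  | step1 m _ ih =>
    refine (abs_sub_le _ _ _).trans ((add_le_add (m.abs_strandWeight_sub_le p N) ih).trans ?_)
    push_cast
    linarith
  | step2 m => exact absurd m (not_move2_three _ _)
  | step3 m _ ih => rwa [m.strandWeight_eq]

theorem wpow_succ (w : BraidWord) (k : ℕ) : wpow w (k + 1) = w ++ wpow w k := by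
  simp [wpow, List.replicate_succ]

theorem winv_wpow (w : BraidWord) (k : ℕ) : winv (wpow w k) = wpow (winv w) k := by
  simp [winv, wpow, List.reverse_flatten, List.map_flatten]

theorem strandWeight_wpow_W (k : ℕ) (N : ℤ) (s : BraidWord) :
    strandWeight 3 N (wpow W k ++ s) = strandWeight 3 (N + 4 * k) s := by
  induction k generalizing N with
  | zero => simp [wpow]
  | succ k ih =>
    rw [wpow_succ, List.append_assoc]
    simp only [W, List.cons_append, List.nil_append, strandWeight] at ih ⊢
    norm_num [letterSign, ih]
    ring_nf

theorem strandWeight_wpow_winv_W (k : ℕ) (N : ℤ) (s : BraidWord) :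
    strandWeight 3 N (wpow (winv W) k ++ s) = strandWeight 3 (N - 4 * k) s := by
  induction k generalizing N with
  | zero => simp [wpow]
  | succ k ih =>
    rw [wpow_succ, List.append_assoc]
    simp [winv, W, strandWeight, letterSign] at ih ⊢
    rw [ih]
    ring_nf

theorem strandWeight_wpow_V (k : ℕ) (N : ℤ) (s : BraidWord) :
    strandWeight 3 N (wpow V k ++ s) = 2 * k * N + strandWeight 3 N s := by
  induction k with
  | zero => simp [wpow]
  | succ k ih =>
    rw [wpow_succ, List.append_assoc]
    simp [V, strandWeight, letterSign] at ih ⊢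
    rw [ih]
    ring

theorem strandWeight_wpow_winv_V (k : ℕ) (N : ℤ) (s : BraidWord) :
    strandWeight 3 N (wpow (winv V) k ++ s) = -(2 * k * N) + strandWeight 3 N s := by
  induction k with
  | zero => simp [wpow]
  | succ k ih =>
    rw [wpow_succ, List.append_assoc]
    simp [winv, V, strandWeight, letterSign] at ih ⊢
    rw [ih]
    ring

theorem strandWeight_ak (k : ℕ) : strandWeight 3 0 (ak k) = -(8 * (k : ℤ) ^ 2) := by
  rw [ak, winv_wpow, winv_wpow, List.append_assoc, List.append_assoc, strandWeight_wpow_winv_W,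
    strandWeight_wpow_V, strandWeight_wpow_W, ← List.append_nil (wpow (winv V) k),
    strandWeight_wpow_winv_V, strandWeight]
  ring

theorem strandWeight_bk (k : ℕ) : strandWeight 3 0 (bk k) = 0 := by
  rw [bk, winv_wpow, winv_wpow, List.append_assoc, List.append_assoc, strandWeight_wpow_winv_W,
    strandWeight_wpow_W, strandWeight_wpow_V, ← List.append_nil (wpow (winv V) k),
    strandWeight_wpow_winv_V, strandWeight]
  ring

/-- For every `k ≥ 1`, `d(a_k, b_k) ≥ 4k²`: every sequence of elementary
modifications from `a_k` to `b_k` contains at least `4k²` modifications of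
type (1). -/
theorem statement_8 (k : ℕ) (hk : 1 ≤ k) :
    ∀ c : ℕ, Reach 3 c (ak k) (bk k) → 4 * k ^ 2 ≤ c := by
  intro c h
  have hc := (abs_le.1 (h.abs_strandWeight_sub_le 3 0)).1
  rw [strandWeight_ak, strandWeight_bk] at hc
  zify
  linarith

end Braid
end
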